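/- arXiv:2301.10578 — 2 statements merged into one kernel-verified Lean document; each statement's English description precedes it below -/
import Mathlib

section
/- Every 2-connected simple graph G satisfies spc(G) ≤ 5; that is, there exists an edge coloring of G with at most 5 colors such that every pair of distinct vertices of G is joined by a strongly proper path. -/
open SimpleGraph

/-- A list of colors is *strongly proper* if any two of its terms at distance
at most 2 are distinct. -/
def StronglyProperSeq {α : Type*} (l : List α) : Prop :=
  ∀ i j : ℕ, i < j → j ≤ i + 2 → ∀ (hi : i < l.length) (hj : j < l.length),
    l.get ⟨i, hi⟩ ≠ l.get ⟨j, hj⟩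

/-- An edge coloring of `G` is strongly proper connected if every pair of distinct
vertices is joined by a path whose sequence of edge colors is strongly proper. -/
def IsStronglyProperConnected {V : Type*} (G : SimpleGraph V) {β : Type*}
    (c : Sym2 V → β) : Prop :=
  ∀ u v : V, u ≠ v → ∃ p : G.Walk u v, p.IsPath ∧ StronglyProperSeq (p.edges.map c)

/-- `G` is `k`-connected: it has more than `k` vertices and deleting any set of
fewer than `k` vertices leaves a connected graph. -/
def KConnected {V : Type*} (k : ℕ) (G : SimpleGraph V) : Prop :=
  k < Nat.card V ∧
    ∀ S : Set V, S.Finite → S.ncard < k → (G.induce Sᶜ).Connected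

namespace StronglyProperSeq

variable {α : Type*}

lemma cons_iff {a : α} {l : List α} :
    StronglyProperSeq (a :: l) ↔ a ∉ l.take 2 ∧ StronglyProperSeq l := by
  constructor
  · intro h
    refine ⟨fun ha => ?_, fun i j hij hj2 hi hj => ?_⟩
    · obtain ⟨i, hi, rfl⟩ := List.mem_iff_getElem.1 ha
      simp only [List.length_take] at hi
      have := h 0 (i + 1) (by omega) (by omega) (by simp) (by simp; omega)
      simp at this
    · simpa using h (i + 1) (j + 1) (by omega) (by omega) (by simpa) (by simpa)
  · rintro ⟨ha, h⟩ i j hij hj2 hi hj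
    obtain ⟨j, rfl⟩ : ∃ k, j = k + 1 := ⟨j - 1, by omega⟩
    cases i with
    | zero =>
      intro he
      refine ha (List.mem_iff_getElem.2 ⟨j, ?_, ?_⟩)
      · simp at hj ⊢; omega
      · simpa using he.symm
    | succ i =>
      simp only [List.length_cons] at hi hj
      simpa using h i j (by omega) (by omega) (by omega) (by omega)

lemma nil : StronglyProperSeq ([] : List α) := fun _ _ _ _ hi => by simp at hi

lemma reverse {l : List α} (h : StronglyProperSeq l) : StronglyProperSeq l.reverse := by
  intro i j hij hj2 hi hj
  simp only [List.length_reverse] at hi hj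
  simpa using (h (l.length - 1 - j) (l.length - 1 - i) (by omega) (by omega)
    (by omega) (by omega)).symm

lemma of_append_right {l₁ l₂ : List α} (h : StronglyProperSeq (l₁ ++ l₂)) :
    StronglyProperSeq l₂ := by
  induction l₁ with
  | nil => exact h
  | cons a l ih => exact ih (cons_iff.1 h).2

lemma of_append_left {l₁ l₂ : List α} (h : StronglyProperSeq (l₁ ++ l₂)) :
    StronglyProperSeq l₁ := by
  have := h.reverse
  rw [List.reverse_append] at this
  simpa using this.of_append_right.reverse

/-- Two strongly proper sequences overlapping in two terms can be glued. -/
lemma glue {l₁ l₂ : List α} {x y : α} (h₁ : StronglyProperSeq (l₁ ++ [x, y]))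
    (h₂ : StronglyProperSeq (x :: y :: l₂)) : StronglyProperSeq (l₁ ++ x :: y :: l₂) := by
  induction l₁ with
  | nil => exact h₂
  | cons a l ih =>
    rw [List.cons_append, cons_iff] at h₁ ⊢
    refine ⟨?_, ih h₁.2⟩
    rcases l with _ | ⟨b, _ | ⟨d, l⟩⟩ <;> simpa using h₁.1

end StronglyProperSeq

lemma exists_fin_five_notMem (l : List (Fin 5)) (hl : l.length ≤ 4) : ∃ x, x ∉ l := by
  by_contra! h
  have : (Finset.univ : Finset (Fin 5)) ⊆ l.toFinset := fun x _ => by simpa using h x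
  have := (Finset.card_le_card this).trans l.toFinset_card_le
  simp at this
  omega

/-- With five colors, a gap of any length between two prescribed pairs can be filled. -/
lemma exists_filling (n : ℕ) {x y x' y' : Fin 5} (h : y ≠ x) (h' : x' ≠ y') :
    ∃ M : List (Fin 5), M.length = n ∧ StronglyProperSeq (y :: x :: M) ∧
      StronglyProperSeq (M ++ [x', y']) := by
  induction n generalizing x y with
  | zero =>
    exact ⟨[], rfl, by simp [StronglyProperSeq.cons_iff, StronglyProperSeq.nil, h],
      by simp [StronglyProperSeq.cons_iff, StronglyProperSeq.nil, h']⟩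
  | succ n ih =>
    obtain ⟨m, hm⟩ := exists_fin_five_notMem [x, y, x', y'] (by simp)
    simp only [List.mem_cons, List.not_mem_nil, or_false, not_or] at hm
    obtain ⟨M, hM, h₁, h₂⟩ := ih (x := m) (y := x) (Ne.symm hm.1)
    refine ⟨m :: M, by simp [hM], StronglyProperSeq.cons_iff.2 ⟨?_, h₁⟩,
      StronglyProperSeq.cons_iff.2 ⟨?_, h₂⟩⟩
    · simpa using ⟨h, Ne.symm hm.2.1⟩
    · have := (StronglyProperSeq.cons_iff.1 (StronglyProperSeq.cons_iff.1 h₁).2).1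
      subst hM
      rcases M with _ | ⟨b, _ | ⟨d, l⟩⟩ <;> simp_all

/-- A strictly increasing list of prescribed length in an interval, avoiding a finite set. -/
lemma exists_increasing_list (T : Set ℚ) (hT : T.Finite) (n : ℕ) {a b : ℚ} (hab : a < b) :
    ∃ L : List ℚ, L.length = n ∧ (a :: (L ++ [b])).Pairwise (· < ·) ∧ ∀ x ∈ L, x ∉ T := by
  induction n generalizing a with
  | zero => exact ⟨[], rfl, by simpa using hab, by simp⟩
  | succ n ih =>
    obtain ⟨x, ⟨hx₁, hx₂⟩, hxT⟩ := ((Set.Ioo_infinite hab).sdiff hT).nonempty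
    obtain ⟨L, hL, hp, hLT⟩ := ih hx₂
    refine ⟨x :: L, by simp [hL], ?_, by simpa using ⟨hxT, hLT⟩⟩
    rw [List.cons_append, List.pairwise_cons]
    refine ⟨fun z hz => ?_, hp⟩
    rcases List.mem_cons.1 hz with rfl | hz
    · exact hx₁
    · exact hx₁.trans ((List.pairwise_cons.1 hp).1 z hz)

/-- A function may be redefined to take prescribed values along a list without repetition. -/
lemma exists_map_eq {α β : Type*} (f : α → β) {l : List α} (hl : l.Nodup) {m : List β}
    (hm : m.length = l.length) : ∃ g : α → β, l.map g = m ∧ ∀ x ∉ l, g x = f x := by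
  classical
  induction l generalizing m with
  | nil => exact ⟨f, by simpa [eq_comm] using hm, fun _ _ => rfl⟩
  | cons a l ih =>
    obtain ⟨b, m, rfl⟩ := List.exists_cons_of_length_eq_add_one (l := m) hm
    rw [List.nodup_cons] at hl
    obtain ⟨g, hg, hgf⟩ := ih hl.2 (m := m) (by simpa using hm)
    refine ⟨Function.update g a b, ?_, fun x hx => ?_⟩
    · rw [List.map_cons, Function.update_self, ← hg]
      congr 1
      exact List.map_congr_left fun x hx =>
        Function.update_of_ne (by rintro rfl; exact hl.1 hx) _ _
    · rw [List.mem_cons, not_or] at hx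
      rw [Function.update_of_ne hx.1, hgf x hx.2]

section

variable {V : Type*} {G : SimpleGraph V}

/-- A walk descending in rank from `v` to `s` inside `S` whose colors, continued by `0`
and either of `k₁`, `k₂`, form a strongly proper sequence. -/
def HasArm (G : SimpleGraph V) (S : Set V) (c : Sym2 V → Fin 5) (r : V → ℚ)
    (s : V) (k₁ k₂ : Fin 5) (v : V) : Prop :=
  ∃ p : G.Walk v s, (∀ x ∈ p.support, x ∈ S) ∧ (p.support.map r).Pairwise (· > ·) ∧
    StronglyProperSeq (p.edges.map c ++ [0, k₁]) ∧ StronglyProperSeq (p.edges.map c ++ [0, k₂])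

/-- A walk inside `S` has the same colors under colorings agreeing on `S`. -/
lemma map_edges_congr {S : Set V} {c c' : Sym2 V → Fin 5} {u v : V} {p : G.Walk u v}
    (hp : ∀ x ∈ p.support, x ∈ S) (hc : ∀ u ∈ S, ∀ v ∈ S, c' s(u, v) = c s(u, v)) :
    p.edges.map c' = p.edges.map c :=
  List.map_congr_left fun e he => by
    induction e with
    | _ u w => exact hc u (hp _ (p.fst_mem_support_of_mem_edges he)) w
                (hp _ (p.snd_mem_support_of_mem_edges he))

lemma HasArm.mono {S S' : Set V} {c c' : Sym2 V → Fin 5} {r r' : V → ℚ}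
    {s : V} {k₁ k₂ : Fin 5} {a : V} (h : HasArm G S c r s k₁ k₂ a) (hS : S ⊆ S')
    (hc : ∀ u ∈ S, ∀ v ∈ S, c' s(u, v) = c s(u, v)) (hr : ∀ u ∈ S, r' u = r u) :
    HasArm G S' c' r' s k₁ k₂ a := by
  obtain ⟨p, hpS, hpr, h₁, h₂⟩ := h
  refine ⟨p, fun x hx => hS (hpS x hx), ?_, ?_, ?_⟩
  · rwa [List.map_congr_left fun u hu => hr u (hpS u hu)]
  · rwa [map_edges_congr hpS hc]
  · rwa [map_edges_congr hpS hc]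

/-- The colors `x`, `y` such that an arm at `v` can be prolonged by a walk into `v` with last color
`x`, provided that the colors of that walk followed by `y` are strongly proper. -/
lemma HasArm.exists_extension {S : Set V} {c : Sym2 V → Fin 5} {r : V → ℚ}
    {s : V} {k₁ k₂ : Fin 5} {a : V} (h : HasArm G S c r s k₁ k₂ a) :
    ∃ x y : Fin 5, y ≠ x ∧ ∀ (S' : Set V) (c' : Sym2 V → Fin 5) (r' : V → ℚ),
      S ⊆ S' → (∀ u ∈ S, ∀ v ∈ S, c' s(u, v) = c s(u, v)) → (∀ u ∈ S, r' u = r u) →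
      ∀ (v : V) (q : G.Walk v a) (l : List (Fin 5)), (∀ x ∈ q.support, x ∈ S') →
        (q.support.map r').Pairwise (· > ·) → q.edges.map c' = l ++ [x] →
        StronglyProperSeq (l ++ [x, y]) → HasArm G S' c' r' s k₁ k₂ v := by
  obtain ⟨p, hpS, hpr, h₁, h₂⟩ := h
  obtain ⟨x, y, hyx, ⟨m₁, e₁, g₁⟩, m₂, e₂, g₂⟩ : ∃ x y, y ≠ x ∧
      (∃ m, p.edges.map c ++ [0, k₁] = y :: m ∧ StronglyProperSeq (x :: y :: m)) ∧
      (∃ m, p.edges.map c ++ [0, k₂] = y :: m ∧ StronglyProperSeq (x :: y :: m)) := by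
    generalize p.edges.map c = l at h₁ h₂
    rcases l with _ | ⟨y, l⟩
    · obtain ⟨x, hx⟩ := exists_fin_five_notMem [0, k₁, k₂] (by simp)
      simp only [List.mem_cons, List.not_mem_nil, or_false, not_or] at hx
      exact ⟨x, 0, Ne.symm hx.1,
        ⟨_, rfl, StronglyProperSeq.cons_iff.2 ⟨by simp [hx], h₁⟩⟩,
        ⟨_, rfl, StronglyProperSeq.cons_iff.2 ⟨by simp [hx], h₂⟩⟩⟩
    · obtain ⟨x, hx⟩ := exists_fin_five_notMem [y, (l ++ [0]).head (by simp)] (by simp)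
      simp only [List.mem_cons, List.not_mem_nil, or_false, not_or] at hx
      refine ⟨x, y, Ne.symm hx.1,
        ⟨_, rfl, StronglyProperSeq.cons_iff.2 ⟨?_, h₁⟩⟩,
        ⟨_, rfl, StronglyProperSeq.cons_iff.2 ⟨?_, h₂⟩⟩⟩ <;>
      rcases l with _ | ⟨b, l⟩ <;> simpa using hx
  refine ⟨x, y, hyx, fun S' c' r' hS hc hr v q l hqS hqr hql hl => ?_⟩
  have hpc := map_edges_congr hpS hc
  have hpr' : p.support.map r' = p.support.map r :=
    List.map_congr_left fun u hu => hr u (hpS u hu)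
  have glued : ∀ {k : Fin 5} {m : List (Fin 5)}, p.edges.map c ++ [0, k] = y :: m →
      StronglyProperSeq (x :: y :: m) →
      StronglyProperSeq ((q.append p).edges.map c' ++ [0, k]) := fun e g => by
    rw [Walk.edges_append, List.map_append, hql, hpc, List.append_assoc, e, List.append_assoc]
    exact hl.glue g
  refine ⟨q.append p, fun z hz => ?_, ?_, glued e₁ g₁, glued e₂ g₂⟩
  · rcases (Walk.mem_support_append_iff _ _).1 hz with hz | hz
    exacts [hqS z hz, hS (hpS z hz)]
  · rw [Walk.support_append, List.map_append, List.pairwise_append]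
    rw [← hpr', ← p.cons_tail_support, List.map_cons, List.pairwise_cons] at hpr
    refine ⟨hqr, hpr.2, fun z hz w hw => (hpr.1 w hw).trans_le ?_⟩
    have hq : q.support = q.support.dropLast ++ [a] := by
      simp
    rw [hq, List.map_append, List.pairwise_append] at hqr
    rw [hq, List.map_append, List.mem_append] at hz
    rcases hz with hz | hz
    · exact (hqr.2.2 z hz (r' a) (by simp)).le
    · simp at hz; exact hz.ge

/-- The first part of a walk, up to its first vertex in `S`. -/
lemma exists_walk_to_first_mem {S : Set V} {u v : V} (p : G.Walk u v) (hv : v ∈ S) :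
    ∃ b ∈ S, ∃ q : G.Walk u b, (∀ x ∈ q.support, x ∈ p.support) ∧
      ∀ x ∈ q.support, x ∈ S → x = b := by
  induction p with
  | nil => exact ⟨_, hv, .nil, by simp, by simp⟩
  | @cons u w v h p ih =>
    by_cases hu : u ∈ S
    · exact ⟨u, hu, .nil, by simp, by simp⟩
    · obtain ⟨b, hb, q, hq, hqS⟩ := ih hv
      refine ⟨b, hb, .cons h q, fun x hx => ?_, fun x hx hxS => ?_⟩
      · rw [Walk.support_cons, List.mem_cons] at hx ⊢
        exact hx.imp_right (hq x)
      · rw [Walk.support_cons, List.mem_cons] at hx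
        rcases hx with rfl | hx
        exacts [absurd hxS hu, hqS x hx hxS]

lemma KConnected.connected {k : ℕ} (hG : KConnected (k + 1) G) : G.Connected := by
  have := hG.2 ∅ Set.finite_empty (by simp)
  rw [Set.compl_empty] at this
  exact (Iso.connected_iff (induceUnivIso G)).1 this

/-- In a 2-connected graph, every proper vertex subset with at least two elements has an ear. -/
lemma KConnected.exists_ear (hG : KConnected 2 G) {S : Set V} (hS : S.Nontrivial)
    (hne : S ≠ Set.univ) : ∃ a ∈ S, ∃ v ∉ S, ∃ b ∈ S, ∃ (h : G.Adj a v) (p : G.Walk v b),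
      (Walk.cons h p).IsPath ∧ ∀ x ∈ p.support, x ∈ S → x = b := by
  classical
  obtain ⟨w, hw⟩ := (Set.ne_univ_iff_exists_notMem S).1 hne
  obtain ⟨a₀, ha₀⟩ := hS.nonempty
  obtain ⟨p₀⟩ := hG.connected.preconnected a₀ w
  obtain ⟨d, -, ha, hv⟩ := p₀.exists_boundary_dart S ha₀ hw
  obtain ⟨b₀, hb₀, hb₀a⟩ := hS.exists_ne d.fst
  have hav : d.snd ≠ d.fst := d.adj.ne'
  obtain ⟨p₁⟩ := (hG.2 {d.fst} (Set.finite_singleton _) (by simp)).preconnected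
    ⟨d.snd, hav⟩ ⟨b₀, hb₀a⟩
  obtain ⟨b, hb, q, hq, hqS⟩ :=
    exists_walk_to_first_mem (p₁.map (Embedding.induce _).toHom) hb₀
  refine ⟨d.fst, ha, d.snd, hv, b, hb, d.adj, q.bypass, ?_, fun x hx =>
    hqS x (q.support_bypass_subset_support hx)⟩
  refine (Walk.cons_isPath_iff _ _).2 ⟨q.bypass_isPath, fun h => ?_⟩
  have := hq _ (q.support_bypass_subset_support h)
  rw [Walk.support_map, List.mem_map] at this
  obtain ⟨x, -, hx⟩ := this
  exact x.2 hx

/-- The vertices of `S` are ranked from `s` to `t`, with `s` and `t` adjacent through an edge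
colored `0`, all of them but `t` have an arm to `s`, and all of them but `s` one to `t`. -/
structure IsArmed (G : SimpleGraph V) (S : Set V) (c : Sym2 V → Fin 5) (r : V → ℚ)
    (s t : V) : Prop where
  left_mem : s ∈ S
  right_mem : t ∈ S
  color_eq : c s(s, t) = 0
  injOn : Set.InjOn r S
  left : ∀ v ∈ S, v ≠ t → r v < r t ∧ HasArm G S c r s 2 4 v
  right : ∀ v ∈ S, v ≠ s → r s < r v ∧ HasArm G S c (fun x => -r x) t 1 3 v

lemma isArmed_pair {s t : V} (h : s ≠ t) :
    ∃ r, IsArmed G {s, t} (fun _ => 0) r s t := by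
  classical
  have hts := h.symm
  refine ⟨fun x => if x = t then 1 else 0, by simp, by simp, rfl, ?_, ?_, ?_⟩
  · rintro x (rfl | rfl) y (rfl | rfl) <;> simp [*]
  · rintro v (rfl | rfl) hv
    · exact ⟨by simp [h], .nil, by simp, by simp, by simp [StronglyProperSeq.cons_iff,
        StronglyProperSeq.nil], by simp [StronglyProperSeq.cons_iff, StronglyProperSeq.nil]⟩
    · exact absurd rfl hv
  · rintro v (rfl | rfl) hv
    · exact absurd rfl hv
    · exact ⟨by simp [h], .nil, by simp, by simp, by simp [StronglyProperSeq.cons_iff,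
        StronglyProperSeq.nil], by simp [StronglyProperSeq.cons_iff, StronglyProperSeq.nil]⟩

/-- An ear can be added to an armed set. -/
lemma IsArmed.extend [Finite V] {S : Set V} {c : Sym2 V → Fin 5} {r : V → ℚ} {s t : V}
    (h : IsArmed G S c r s t) {a b : V} (ha : a ∈ S) (hb : b ∈ S) (hab : r a < r b)
    (w : G.Walk a b) (hw : w.IsPath) (hlen : 2 ≤ w.length)
    (hwS : ∀ x ∈ w.support, x ∈ S → x = a ∨ x = b)
    (hwE : ∀ u ∈ S, ∀ v ∈ S, s(u, v) ∉ w.edges) :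
    ∃ c' r', IsArmed G (S ∪ {x | x ∈ w.support}) c' r' s t := by
  classical
  have hrt : ∀ v ∈ S, r v ≤ r t := fun v hv => by
    by_cases e : v = t
    exacts [e ▸ le_rfl, (h.left v hv e).1.le]
  have hrs : ∀ v ∈ S, r s ≤ r v := fun v hv => by
    by_cases e : v = s
    exacts [e ▸ le_rfl, (h.right v hv e).1.le]
  have hat : a ≠ t := by rintro rfl; exact hab.not_ge (hrt b hb)
  have hbs : b ≠ s := by rintro rfl; exact hab.not_ge (hrs a ha)
  obtain ⟨x, y, hyx, hx⟩ := (h.left a ha hat).2.exists_extension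
  obtain ⟨x', y', hyx', hx'⟩ := (h.right b hb hbs).2.exists_extension
  -- colors
  obtain ⟨M, hM, hM₁, hM₂⟩ := exists_filling (w.length - 2) hyx hyx'.symm
  obtain ⟨c', hc', hc'S⟩ := exists_map_eq c (m := x :: (M ++ [x'])) hw.isTrail.edges_nodup
    (by simp [hM]; omega)
  have hcS : ∀ u ∈ S, ∀ v ∈ S, c' s(u, v) = c s(u, v) := fun u hu v hv =>
    hc'S _ (hwE u hu v hv)
  -- ranks
  obtain ⟨I, hI⟩ : ∃ I, w.support = a :: (I ++ [b]) := by
    cases w with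
    | nil => simp at hlen
    | cons e p => exact ⟨p.support.dropLast, by simp⟩
  have hnd := hw.support_nodup
  rw [hI] at hnd
  have hIS : ∀ z ∈ I, z ∉ S := fun z hz hzS => by
    rcases hwS z (by simp [hI, hz]) hzS with rfl | rfl
    · simp [hz] at hnd
    · simp only [List.nodup_cons, List.nodup_append] at hnd
      exact hnd.2.2.2 z hz z (by simp) rfl
  have hInd : I.Nodup := by
    simp only [List.nodup_cons, List.nodup_append] at hnd
    exact hnd.2.1
  obtain ⟨L, hL, hLp, hLS⟩ := exists_increasing_list (r '' S) (Set.toFinite _) I.length hab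
  obtain ⟨r', hr', hr'S⟩ := exists_map_eq r hInd hL
  have hrS : ∀ u ∈ S, r' u = r u := fun u hu => hr'S u fun hI => hIS u hI hu
  have hrw : (w.support.map r').Pairwise (· < ·) := by
    simpa [hI, hr', hrS a ha, hrS b hb] using hLp
  have hrL : ∀ z ∈ I, r' z ∈ L := fun z hz => hr' ▸ List.mem_map_of_mem hz
  have hrI : ∀ z ∈ I, r a < r' z ∧ r' z < r b := fun z hz => by
    rw [List.pairwise_cons, List.pairwise_append] at hLp
    exact ⟨hLp.1 _ (by simp [hrL z hz]), hLp.2.2.2 _ (hrL z hz) _ (by simp)⟩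
  have hSS' : S ⊆ S ∪ {x | x ∈ w.support} := Set.subset_union_left
  have hmem : ∀ z ∈ S ∪ {x | x ∈ w.support}, z ∈ S ∨ z ∈ I := by
    rintro z (hz | hz)
    · exact .inl hz
    · have hz : z ∈ w.support := hz
      rw [hI, List.mem_cons, List.mem_append, List.mem_singleton] at hz
      rcases hz with rfl | hz | rfl
      exacts [.inl ha, .inr hz, .inl hb]
  -- the arms of the inner vertices of the ear
  have arms : ∀ z ∈ I, HasArm G (S ∪ {x | x ∈ w.support}) c' r' s 2 4 z ∧
      HasArm G (S ∪ {x | x ∈ w.support}) c' (fun x => -r' x) t 1 3 z := fun z hz => by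
    have hzw : z ∈ w.support := by simp [hI, hz]
    have hspec := w.take_spec hzw
    have hsub₁ := w.support_takeUntil_prefix_support hzw
    have hsub₂ := w.support_dropUntil_suffix_support hzw
    generalize w.takeUntil z hzw = p at hspec hsub₁
    generalize w.dropUntil z hzw = q at hspec hsub₂
    have hE : p.edges.map c' ++ q.edges.map c' = x :: (M ++ [x']) := by
      rw [← hc', ← hspec, Walk.edges_append, List.map_append]
    obtain ⟨E₁, hE₁⟩ : ∃ E, p.edges.map c' = x :: E := by
      cases p with
      | nil => exact absurd ha (hIS _ hz)
      | cons e p => exact ⟨p.edges.map c', by simp at hE ⊢; exact hE.1⟩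
    obtain ⟨E₂, hE₂⟩ : ∃ E, q.edges.map c' = E ++ [x'] := by
      rcases List.eq_nil_or_concat (q.edges.map c') with hn | ⟨E, e, hn⟩
      · cases q with
        | nil => exact absurd hb (hIS _ hz)
        | cons e q => simp at hn
      · refine ⟨E, ?_⟩
        rw [List.concat_eq_append] at hn
        rw [hn, hE₁, List.cons_append, List.cons_inj_right, ← List.append_assoc] at hE
        rw [hn, (List.append_inj' hE rfl).2]
    obtain rfl : E₁ ++ E₂ = M := by
      simpa [hE₁, hE₂, ← List.append_assoc] using hE
    constructor
    · refine hx _ c' r' hSS' hcS hrS z p.reverse E₁.reverse (fun u hu => ?_) ?_ ?_ ?_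
      · exact .inr (hsub₁.subset (by simpa using hu))
      · rw [Walk.support_reverse, List.map_reverse, List.pairwise_reverse]
        exact hrw.sublist (hsub₁.sublist.map _)
      · simp [hE₁]
      · rw [← List.cons_append, ← List.cons_append] at hM₁
        simpa using hM₁.of_append_left.reverse
    · refine hx' _ c' (fun x => -r' x) hSS' hcS (fun u hu => by simp [hrS u hu]) z q E₂
        (fun u hu => .inr (hsub₂.subset hu)) ?_ hE₂ ?_
      · have := hrw.sublist (hsub₂.sublist.map r')
        rw [List.pairwise_map] at this ⊢
        exact this.imp fun h => neg_lt_neg h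
      · rw [List.append_assoc] at hM₂
        exact hM₂.of_append_right
  refine ⟨c', r', hSS' h.left_mem, hSS' h.right_mem, ?_, ?_, ?_, ?_⟩
  · rw [hcS s h.left_mem t h.right_mem, h.color_eq]
  · have hne : ∀ u ∈ S, ∀ v ∈ I, r' u ≠ r' v := fun u hu v hv e =>
      hLS _ (hrL v hv) ⟨u, hu, by rw [← e, hrS u hu]⟩
    intro u hu v hv e
    rcases hmem u hu with hu | hu <;> rcases hmem v hv with hv | hv
    · exact h.injOn hu hv (by rwa [← hrS u hu, ← hrS v hv])
    · exact absurd e (hne u hu v hv)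
    · exact absurd e.symm (hne v hv u hu)
    · refine List.inj_on_of_nodup_map (f := r') ?_ hu hv e
      rw [hr']
      rw [List.pairwise_cons, List.pairwise_append] at hLp
      exact hLp.2.1.imp ne_of_lt
  · intro v hv hvt
    rw [hrS t h.right_mem]
    rcases hmem v hv with hv | hv
    · rw [hrS v hv]
      exact ⟨(h.left v hv hvt).1, (h.left v hv hvt).2.mono hSS' hcS hrS⟩
    · exact ⟨(hrI v hv).2.trans_le (hrt b hb), (arms v hv).1⟩
  · intro v hv hvs
    rw [hrS s h.left_mem]
    rcases hmem v hv with hv | hv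
    · rw [hrS v hv]
      exact ⟨(h.right v hv hvs).1,
        (h.right v hv hvs).2.mono hSS' hcS fun u hu => by simp [hrS u hu]⟩
    · exact ⟨(hrs a ha).trans_lt (hrI v hv).1, (arms v hv).2⟩

/-- In an armed graph, any two vertices are joined by a strongly proper path through `s` and `t`. -/
lemma IsArmed.exists_path {c : Sym2 V → Fin 5} {r : V → ℚ} {s t : V}
    (h : IsArmed G Set.univ c r s t) (hst : G.Adj s t) {u v : V} (huv : r u < r v) :
    ∃ p : G.Walk u v, p.IsPath ∧ StronglyProperSeq (p.edges.map c) := by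
  have hut : u ≠ t := by
    rintro rfl
    exact lt_asymm huv (h.left v trivial (by rintro rfl; exact lt_irrefl _ huv)).1
  have hvs : v ≠ s := by
    rintro rfl
    exact lt_asymm huv (h.right u trivial (by rintro rfl; exact lt_irrefl _ huv)).1
  obtain ⟨-, p, -, hp, hp₁, hp₂⟩ := h.left u trivial hut
  obtain ⟨-, q, -, hq, hq₁, hq₂⟩ := h.right v trivial hvs
  have hpu : ∀ x ∈ p.support, r x ≤ r u := fun x hx => by
    rw [← p.cons_tail_support, List.map_cons, List.pairwise_cons] at hp
    rw [← p.cons_tail_support, List.mem_cons] at hx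
    rcases hx with rfl | hx
    exacts [le_rfl, (hp.1 _ (List.mem_map_of_mem hx)).le]
  have hqv : ∀ x ∈ q.support, r v ≤ r x := fun x hx => by
    rw [← q.cons_tail_support, List.map_cons, List.pairwise_cons] at hq
    rw [← q.cons_tail_support, List.mem_cons] at hx
    rcases hx with rfl | hx
    exacts [le_rfl, (neg_lt_neg_iff.1 (hq.1 _ (List.mem_map_of_mem hx))).le]
  refine ⟨p.append (.cons hst q.reverse), ?_, ?_⟩
  · rw [Walk.isPath_def, Walk.support_append, Walk.support_cons, List.tail_cons,
      Walk.support_reverse, List.nodup_append]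
    refine ⟨.of_map r (hp.imp ne_of_gt), List.nodup_reverse.2 (.of_map _ (hq.imp ne_of_gt)), ?_⟩
    rintro x hx _ hy rfl
    exact huv.not_ge ((hqv x (List.mem_reverse.1 hy)).trans (hpu x hx))
  · rw [Walk.edges_append, Walk.edges_cons, Walk.edges_reverse, List.map_append, List.map_cons,
      h.color_eq, List.map_reverse]
    replace hq₁ := hq₁.reverse
    replace hq₂ := hq₂.reverse
    simp only [List.reverse_append, List.reverse_cons, List.reverse_nil, List.nil_append,
      List.cons_append] at hq₁ hq₂
    generalize (q.edges.map c).reverse = l at hq₁ hq₂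
    rcases l with _ | ⟨k, l⟩
    · rw [List.append_cons] at hp₁
      exact hp₁.of_append_left
    · have hk : k = 2 ∨ k = 4 := by
        have h₁ := (StronglyProperSeq.cons_iff.1 hq₁).1
        have h₂ := (StronglyProperSeq.cons_iff.1 hq₂).1
        have h₃ := (StronglyProperSeq.cons_iff.1 (StronglyProperSeq.cons_iff.1 hq₁).2).1
        clear * - h₁ h₂ h₃
        simp at h₁ h₂ h₃
        omega
      rcases hk with rfl | rfl
      · exact hp₁.glue (StronglyProperSeq.cons_iff.1 hq₁).2
      · exact hp₂.glue (StronglyProperSeq.cons_iff.1 hq₁).2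

end

/-- Every 2-connected graph `G` satisfies `spc(G) ≤ 5`. -/
theorem spc_le_five_of_two_connected {V : Type*} (G : SimpleGraph V)
    (hG : KConnected 2 G) :
    ∃ c : Sym2 V → Fin 5, IsStronglyProperConnected G c := by
  have : Finite V := Nat.finite_of_card_ne_zero (by have := hG.1; omega)
  have : Nontrivial V := Finite.one_lt_card_iff_nontrivial.1 (by have := hG.1; omega)
  obtain ⟨s⟩ := hG.connected.nonempty
  obtain ⟨t, hst⟩ := hG.connected.preconnected.exists_adj_of_nontrivial s
  obtain ⟨r₀, h₀⟩ := isArmed_pair (G := G) hst.ne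
  obtain ⟨S, -, ⟨c, r, h⟩, hmax⟩ :=
    (Set.toFinite {S : Set V | ∃ c r, IsArmed G S c r s t}).exists_le_maximal ⟨_, _, h₀⟩
  obtain rfl : S = Set.univ := by
    by_contra hne
    obtain ⟨a, ha, v, hv, b, hb, e, p, hp, hpS⟩ :=
      hG.exists_ear ⟨s, h.left_mem, t, h.right_mem, hst.ne⟩ hne
    have hvb : v ≠ b := by rintro rfl; exact hv hb
    have hpE : ∀ u ∈ S, ∀ w ∈ S, s(u, w) ∉ (Walk.cons e p).edges := fun u hu w hw he => by
      rw [Walk.edges_cons, List.mem_cons] at he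
      rcases he with he | he
      · rcases Sym2.eq_iff.1 he with ⟨-, rfl⟩ | ⟨rfl, -⟩ <;> exact hv ‹_›
      · refine (p.adj_of_mem_edges he).ne ?_
        rw [hpS u (p.fst_mem_support_of_mem_edges he) hu,
          hpS w (p.snd_mem_support_of_mem_edges he) hw]
    have hwS : ∀ x ∈ (Walk.cons e p).support, x ∈ S → x = a ∨ x = b := fun x hx hxS => by
      rw [Walk.support_cons, List.mem_cons] at hx
      exact hx.imp_right fun hx => hpS x hx hxS
    have hlen : 2 ≤ (Walk.cons e p).length := by
      cases p with
      | nil => exact absurd rfl hvb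
      | cons e' p => simp
    have hab : r a ≠ r b := fun hr => by
      obtain rfl := h.injOn ha hb hr
      simp at hp
    obtain ⟨c', r', h'⟩ :
        ∃ c' r', IsArmed G (S ∪ {x | x ∈ (Walk.cons e p).support}) c' r' s t := by
      rcases lt_or_gt_of_ne hab with hab | hab
      · exact h.extend ha hb hab _ hp hlen hwS hpE
      · have := h.extend hb ha hab (Walk.cons e p).reverse hp.reverse (by simpa using hlen)
          (fun x hx hxS => (hwS x (by rwa [Walk.support_reverse, List.mem_reverse] at hx) hxS).symm)
          (fun u hu w hw he => hpE u hu w hw (by rwa [Walk.edges_reverse, List.mem_reverse] at he))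
        simpa only [Walk.support_reverse, List.mem_reverse] using this
    exact hv (hmax ⟨c', r', h'⟩ Set.subset_union_left (.inr (by simp)))
  refine ⟨c, fun u v huv => ?_⟩
  rcases lt_or_gt_of_ne (fun e => huv (h.injOn trivial trivial e)) with hr | hr
  · exact h.exists_path hst hr
  · obtain ⟨p, hp, hc⟩ := h.exists_path hst hr
    exact ⟨p.reverse, hp.reverse, by simpa using hc.reverse⟩
end

section
/- Every 4-connected simple graph G satisfies nrc(G) ≤ 6; that is, there exists an edge coloring of G with at most 6 colors such that every pair of distinct vertices of G is joined by a nonrepetitive path. -/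
open SimpleGraph

/-- A list is *nonrepetitive* if it contains no block of the form `y ++ y`
with `y` nonempty. -/
def NonrepetitiveSeq {α : Type*} (l : List α) : Prop :=
  ¬ ∃ a y b : List α, y ≠ [] ∧ l = a ++ y ++ y ++ b

/-- An edge coloring of `G` is nonrepetitively connected if every pair of distinct
vertices is joined by a path whose sequence of edge colors is nonrepetitive. -/
def IsNonrepetitivelyConnected {V : Type*} (G : SimpleGraph V) {β : Type*}
    (c : Sym2 V → β) : Prop :=
  ∀ u v : V, u ≠ v → ∃ p : G.Walk u v, p.IsPath ∧ NonrepetitiveSeq (p.edges.map c)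

/-- The Thue–Morse sequence. -/
def thueMorse (n : ℕ) : Bool :=
  if h : n = 0 then false else xor (thueMorse (n / 2)) (n % 2 == 1)
termination_by n
decreasing_by omega

theorem thueMorse_two_mul (n : ℕ) : thueMorse (2 * n) = thueMorse n := by
  rcases Nat.eq_zero_or_pos n with rfl | hn
  · rfl
  · rw [thueMorse, dif_neg (by omega), Nat.mul_div_cancel_left n two_pos]
    simp

theorem thueMorse_two_mul_add_one (n : ℕ) : thueMorse (2 * n + 1) = !thueMorse n := by
  rw [thueMorse, dif_neg (by omega), show (2 * n + 1) / 2 = n by omega,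
    show (2 * n + 1) % 2 = 1 by omega]
  simp

theorem odd_of_thueMorse_eq_succ {p : ℕ} (h : thueMorse p = thueMorse (p + 1)) : p % 2 = 1 := by
  by_contra hp
  obtain ⟨a, rfl⟩ : ∃ a, p = 2 * a := ⟨p / 2, by omega⟩
  simp [thueMorse_two_mul, thueMorse_two_mul_add_one] at h

/-- Every five consecutive terms of the Thue–Morse sequence contain two equal adjacent ones. -/
theorem exists_thueMorse_eq_succ (i : ℕ) :
    ∃ j ≤ 3, thueMorse (i + j) = thueMorse (i + j + 1) := by
  by_contra! hne
  have alternating : ∀ a : ℕ,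
      ¬ (thueMorse a = thueMorse (a + 1) ∧ thueMorse (a + 1) = thueMorse (a + 2)) := by
    rintro a ⟨h₀, h₁⟩
    have := odd_of_thueMorse_eq_succ h₀
    have := odd_of_thueMorse_eq_succ h₁
    omega
  have h0 := hne 0 (by omega)
  have h1 := hne 1 (by omega)
  have h2 := hne 2 (by omega)
  have h3 := hne 3 (by omega)
  have skip : ∀ x y z : Bool, x ≠ y → y ≠ z → x = z := by decide
  have s02 := skip _ _ _ h0 h1
  have s24 := skip _ _ _ h2 h3
  rcases Nat.even_or_odd' i with ⟨a, rfl | rfl⟩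
  · have e0 := thueMorse_two_mul a
    have e2 := thueMorse_two_mul (a + 1)
    have e4 := thueMorse_two_mul (a + 2)
    exact alternating a ⟨e0.symm.trans (s02.trans e2), e2.symm.trans (s24.trans e4)⟩
  · have e0 := thueMorse_two_mul_add_one a
    have e2 := thueMorse_two_mul_add_one (a + 1)
    have e4 := thueMorse_two_mul_add_one (a + 2)
    exact alternating a ⟨Bool.not_inj (e0.symm.trans (s02.trans e2)),
      Bool.not_inj (e2.symm.trans (s24.trans e4))⟩

/-- The Thue–Morse sequence is overlap-free. -/
theorem thueMorse_overlapFree {n : ℕ} (hn : 0 < n) (i : ℕ) :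
    ¬ ∀ j ≤ n, thueMorse (i + j) = thueMorse (i + n + j) := by
  induction n using Nat.strong_induction_on generalizing i with
  | _ n ih =>
  intro h
  rcases Nat.even_or_odd' n with ⟨m, rfl | rfl⟩
  · apply ih m (by omega) (by omega) (i / 2)
    intro j hj
    have hj' := h (2 * j) (by omega)
    rcases Nat.even_or_odd' i with ⟨a, rfl | rfl⟩
    · rw [show 2 * a + 2 * j = 2 * (a + j) by ring,
        show 2 * a + 2 * m + 2 * j = 2 * (a + m + j) by ring,
        thueMorse_two_mul, thueMorse_two_mul] at hj'
      rwa [show 2 * a / 2 = a by omega]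
    · rw [show 2 * a + 1 + 2 * j = 2 * (a + j) + 1 by ring,
        show 2 * a + 1 + 2 * m + 2 * j = 2 * (a + m + j) + 1 by ring,
        thueMorse_two_mul_add_one, thueMorse_two_mul_add_one] at hj'
      rw [show (2 * a + 1) / 2 = a by omega]
      simpa using hj'
  · have key : ∀ j, j + 1 ≤ 2 * m + 1 → thueMorse (i + j) ≠ thueMorse (i + j + 1) := by
      intro j hj heq
      have h₀ := h j (by omega)
      have h₁ := h (j + 1) hj
      have := odd_of_thueMorse_eq_succ heq
      have := odd_of_thueMorse_eq_succ (p := i + (2 * m + 1) + j) (by grind)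
      omega
    obtain rfl | hm := Nat.eq_zero_or_pos m
    · exact key 0 (by omega) (h 0 (by omega))
    · obtain ⟨j, hj, heq⟩ := exists_thueMorse_eq_succ i
      by_cases hjm : j + 1 ≤ 2 * m + 1
      · exact key j hjm heq
      · obtain ⟨rfl, rfl⟩ : m = 1 ∧ j = 3 := by omega
        refine key 0 (by omega) ?_
        have h₀ := h 0 (by omega)
        have h₁ := h 1 (by omega)
        grind

/-- A squarefree ternary sequence: the first differences of the Thue–Morse sequence. -/
def ternaryThue (n : ℕ) : Fin 3 :=
  if thueMorse n = thueMorse (n + 1) then 0 else if thueMorse n then 1 else 2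

theorem ternaryThue_squarefree {n : ℕ} (hn : 0 < n) (i : ℕ) :
    ¬ ∀ j < n, ternaryThue (i + j) = ternaryThue (i + n + j) := by
  intro h
  let τ : ℕ → ℤ := fun n ↦ if thueMorse n then 1 else 0
  have step : ∀ a b, ternaryThue a = ternaryThue b → τ (a + 1) - τ a = τ (b + 1) - τ b := by
    intro a b hab
    simp only [ternaryThue, τ] at hab ⊢
    cases ha : thueMorse a <;> cases hb : thueMorse b <;> cases ha' : thueMorse (a + 1) <;>
      cases hb' : thueMorse (b + 1) <;> simp_all
  have tele : ∀ j ≤ n, τ (i + j) - τ i = τ (i + n + j) - τ (i + n) := by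
    intro j
    induction j with
    | zero => simp
    | succ j ih =>
      intro hj
      have h₁ := ih (by omega)
      have h₂ := step _ _ (h j (by omega))
      simp only [add_assoc] at h₁ h₂ ⊢
      linarith
  have bounds : ∀ m, 0 ≤ τ m ∧ τ m ≤ 1 := by
    intro m
    simp only [τ]
    split <;> simp
  have hτ : τ (i + n) = τ i := by
    have := tele n le_rfl
    have := bounds i
    have := bounds (i + n + n)
    omega
  refine thueMorse_overlapFree hn i fun j hj ↦ ?_
  have := tele j hj
  rw [hτ] at this
  have hj' : τ (i + j) = τ (i + n + j) := by linarith
  simp only [τ] at hj'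
  cases h₀ : thueMorse (i + j) <;> cases h₁ : thueMorse (i + n + j) <;> simp_all

namespace NonrepetitiveSeq

variable {α β : Type*}

theorem of_isInfix {l l' : List α} (h : NonrepetitiveSeq l) (hl : l' <:+: l) :
    NonrepetitiveSeq l' := by
  rintro ⟨a, y, b, hy, rfl⟩
  obtain ⟨s, t, rfl⟩ := hl
  exact h ⟨s ++ a, y, b ++ t, hy, by simp⟩

theorem reverse {l : List α} (h : NonrepetitiveSeq l) : NonrepetitiveSeq l.reverse := by
  rintro ⟨a, y, b, hy, hl⟩
  refine h ⟨b.reverse, y.reverse, a.reverse, by simpa using hy, ?_⟩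
  rw [← l.reverse_reverse, hl]
  simp

theorem map {f : α → β} (hf : Function.Injective f) {l : List α} (h : NonrepetitiveSeq l) :
    NonrepetitiveSeq (l.map f) := by
  rintro ⟨a, y, b, hy, hl⟩
  simp only [List.map_eq_append_iff] at hl
  obtain ⟨_, b', rfl, ⟨_, y₂, rfl, ⟨a', y₁, rfl, rfl, rfl⟩, hy₂⟩, rfl⟩ := hl
  obtain rfl := hf.list_map hy₂
  exact h ⟨a', _, b', by simpa using hy, rfl⟩

/-- The concatenation of nonrepetitive sequences over disjoint alphabets is nonrepetitive. -/
theorem append {l₁ l₂ : List α} (h₁ : NonrepetitiveSeq l₁) (h₂ : NonrepetitiveSeq l₂)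
    (P : α → Prop) (hP₁ : ∀ x ∈ l₁, P x) (hP₂ : ∀ x ∈ l₂, ¬ P x) :
    NonrepetitiveSeq (l₁ ++ l₂) := by
  classical
  rintro ⟨a, y, b, hy, hl⟩
  have e₁ := congrArg (List.filter fun x ↦ decide (P x)) hl
  have e₂ := congrArg (List.filter fun x ↦ decide (¬ P x)) hl
  simp only [List.filter_append] at e₁ e₂
  rw [List.filter_eq_self.2 (by simpa using hP₁), List.filter_eq_nil_iff.2 (by simpa using hP₂),
    List.append_nil] at e₁
  rw [List.filter_eq_nil_iff.2 (by simpa using hP₁), List.filter_eq_self.2 (by simpa using hP₂),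
    List.nil_append] at e₂
  have y₁ : y.filter (fun x ↦ decide (P x)) = [] := by
    by_contra hne
    exact h₁ ⟨_, _, _, hne, e₁⟩
  have y₂ : y.filter (fun x ↦ decide (¬ P x)) = [] := by
    by_contra hne
    exact h₂ ⟨_, _, _, hne, e₂⟩
  obtain ⟨x, hx⟩ := List.exists_mem_of_ne_nil y hy
  rw [List.filter_eq_nil_iff] at y₁ y₂
  have := y₁ x hx
  have := y₂ x hx
  simp_all

end NonrepetitiveSeq

theorem nonrepetitiveSeq_map_ternaryThue (s n : ℕ) :
    NonrepetitiveSeq ((List.range' s n).map ternaryThue) := by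
  rintro ⟨a, y, b, hy, hl⟩
  have hlen := congrArg List.length hl
  simp only [List.length_map, List.length_range', List.length_append] at hlen
  refine ternaryThue_squarefree (List.length_pos_iff.2 hy) (s + a.length) fun j hj ↦ ?_
  have get : ∀ m < n, ((a ++ y ++ y ++ b)[m]?) = some (ternaryThue (s + m)) := by
    intro m hm
    rw [← hl]
    simp [hm]
  have h₁ := get (a.length + j) (by omega)
  have h₂ := get (a.length + y.length + j) (by omega)
  have e₁ : (a ++ y ++ y ++ b)[a.length + j]? = y[j]? := by grind
  have e₂ : (a ++ y ++ y ++ b)[a.length + y.length + j]? = y[j]? := by grind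
  rw [e₁] at h₁
  rw [e₂, h₁] at h₂
  simpa [add_assoc] using h₂

/-- In a `k`-connected graph at least `k` edges leave every proper nonempty set of vertices. -/
theorem KConnected.le_ncard_boundary {V : Type*} [Finite V] {G : SimpleGraph V} {k : ℕ}
    (hG : KConnected k G) {X : Set V} (hX : X.Nonempty) (hX' : Xᶜ.Nonempty) :
    k ≤ {d : V × V | d.1 ∈ X ∧ d.2 ∉ X ∧ G.Adj d.1 d.2}.ncard := by
  classical
  set D := {d : V × V | d.1 ∈ X ∧ d.2 ∉ X ∧ G.Adj d.1 d.2} with hD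
  by_contra! hlt
  have hcard : k ≤ (X ×ˢ Xᶜ).ncard := by
    have h₁ := Set.ncard_add_ncard_compl X
    have h₂ := hX.ncard_pos
    have h₃ := hX'.ncard_pos
    have h₄ := hG.1
    rw [Set.ncard_prod]
    nlinarith
  obtain ⟨⟨x, y⟩, ⟨hx, hy⟩, hxy⟩ := Set.exists_mem_notMem_of_ncard_lt_ncard (hlt.trans_le hcard)
  have hadj : ¬ G.Adj x y := fun h ↦ hxy ⟨hx, hy, h⟩
  let S : Set V := (fun d : V × V ↦ if d.1 = x then d.2 else d.1) '' D
  have hS : S.ncard < k := (Set.ncard_image_le D.toFinite).trans_lt hlt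
  have hxS : x ∉ S := by
    rintro ⟨⟨a, b⟩, ⟨ha, hb, hab⟩, h⟩
    dsimp only at h ha hb
    grind
  have hyS : y ∉ S := by
    rintro ⟨⟨a, b⟩, ⟨ha, hb, hab⟩, h⟩
    dsimp only at h ha hb hab hy
    have : y ∉ X := hy
    grind
  obtain ⟨p⟩ := (hG.2 S S.toFinite hS).preconnected ⟨x, hxS⟩ ⟨y, hyS⟩
  obtain ⟨d, -, hd₁, hd₂⟩ := p.exists_boundary_dart {v | v.1 ∈ X} hx hy
  have hmem : (d.fst.1, d.snd.1) ∈ D := ⟨hd₁, hd₂, d.adj⟩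
  have himg : (if d.fst.1 = x then d.snd.1 else d.fst.1) ∈ S := ⟨_, hmem, rfl⟩
  split at himg
  · exact d.snd.2 himg
  · exact d.fst.2 himg

namespace SimpleGraph

variable {V : Type*} {G H K F : SimpleGraph V}

theorem Reachable.of_forall_adj (h : ∀ ⦃a b⦄, H.Adj a b → K.Reachable a b) {u v : V}
    (huv : H.Reachable u v) : K.Reachable u v := by
  obtain ⟨p⟩ := huv
  induction p with
  | nil => rfl
  | cons hadj _ ih => exact (h hadj).trans ih

theorem card_connectedComponent_lt [Finite V] (hle : K ≤ F) {u v : V} (hF : F.Reachable u v)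
    (hK : ¬ K.Reachable u v) :
    Nat.card F.ConnectedComponent < Nat.card K.ConnectedComponent := by
  have hsurj := ConnectedComponent.surjective_map_ofLE hle
  refine lt_of_le_of_ne (Nat.card_le_card_of_surjective _ hsurj) fun heq ↦ hK ?_
  have hinj := ((Nat.bijective_iff_surjective_and_card _).2 ⟨hsurj, heq.symm⟩).1
  exact ConnectedComponent.exact
    (hinj (a₁ := K.connectedComponentMk u) (a₂ := K.connectedComponentMk v)
      (ConnectedComponent.sound hF))

/-- Each edge of a forest outside a given subgraph merges two components of that subgraph. -/
theorem IsAcyclic.ncard_edgeSet_sdiff_add_card_le [Finite V] (hF : F.IsAcyclic) (hle : K ≤ F) :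
    (F.edgeSet \ K.edgeSet).ncard + Nat.card F.ConnectedComponent ≤
      Nat.card K.ConnectedComponent := by
  induction hn : (F.edgeSet \ K.edgeSet).ncard generalizing F with
  | zero =>
    rw [Set.ncard_eq_zero (Set.toFinite _), Set.sdiff_eq_empty, edgeSet_subset_edgeSet] at hn
    rw [le_antisymm hn hle, zero_add]
  | succ n ih =>
    obtain ⟨e, he, heK⟩ : (F.edgeSet \ K.edgeSet).Nonempty := by
      rw [← Set.ncard_pos (Set.toFinite _)]
      omega
    induction e with | _ u v =>
    have hle' : F.deleteEdges {s(u, v)} ≤ F := deleteEdges_le _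
    have hbridge := isAcyclic_iff_forall_isBridge.1 hF he
    rw [isBridge_iff] at hbridge
    have hlt := card_connectedComponent_lt hle' (Adj.reachable he) hbridge
    have hK : K ≤ F.deleteEdges {s(u, v)} := by
      intro a b hab
      rw [deleteEdges_adj]
      refine ⟨hle hab, fun h ↦ heK ?_⟩
      rw [← Set.mem_singleton_iff.1 h]
      exact hab
    have := ih (hF.anti hle') hK (by
      rw [edgeSet_deleteEdges, sdiff_right_comm,
        Set.ncard_sdiff_singleton_of_mem (show s(u, v) ∈ F.edgeSet \ K.edgeSet from ⟨he, heK⟩), hn]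
      rfl)
    omega

section TreePacking

variable {ι : Type*}

/-- A family of pairwise edge-disjoint forests in `G`. -/
structure IsForestPacking (G : SimpleGraph V) (T : ι → SimpleGraph V) : Prop where
  le : ∀ i, T i ≤ G
  isAcyclic : ∀ i, (T i).IsAcyclic
  disjoint : ∀ ⦃i j a b⦄, (T i).Adj a b → (T j).Adj a b → i = j

/-- A forest packing with the largest possible total number of edges. -/
def IsMaxForestPacking (G : SimpleGraph V) (T : ι → SimpleGraph V) : Prop :=
  IsForestPacking G T ∧ ∀ T' : ι → SimpleGraph V, IsForestPacking G T' →
    ∑ᶠ i, (T' i).edgeSet.ncard ≤ ∑ᶠ i, (T i).edgeSet.ncard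

/-- An edge of `G` used by no member of the family `T`. -/
def IsUnused (G : SimpleGraph V) (T : ι → SimpleGraph V) (a b : V) : Prop :=
  G.Adj a b ∧ ∀ i, ¬ (T i).Adj a b

theorem exists_isMaxForestPacking [Finite V] [Finite ι] (G : SimpleGraph V) :
    ∃ T : ι → SimpleGraph V, IsMaxForestPacking G T := by
  obtain ⟨T, hT, hmax⟩ := Set.exists_max_image {T : ι → SimpleGraph V | IsForestPacking G T}
    (fun T ↦ ∑ᶠ i, (T i).edgeSet.ncard) (Set.toFinite _)
    ⟨fun _ ↦ ⊥, fun _ ↦ bot_le, fun _ ↦ isAcyclic_bot, fun _ _ _ _ h ↦ h.elim⟩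
  exact ⟨T, hT, hmax⟩

open Classical in
theorem IsForestPacking.update {T : ι → SimpleGraph V} (hT : IsForestPacking G T) {a b : V}
    (hab : IsUnused G T a b) {i : ι} (hK : K ≤ T i) (hnr : ¬ K.Reachable a b) :
    IsForestPacking G (Function.update T i (K ⊔ edge a b)) := by
  have hadj : ∀ {j c d}, (Function.update T i (K ⊔ edge a b) j).Adj c d →
      (T j).Adj c d ∨ (j = i ∧ s(c, d) = s(a, b)) := by
    intro j c d h
    rcases eq_or_ne j i with rfl | hj
    · rw [Function.update_self, sup_adj, edge_adj] at h
      rcases h with h | h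
      · exact .inl (hK h)
      · exact .inr ⟨rfl, by grind⟩
    · rw [Function.update_of_ne hj] at h
      exact .inl h
  have unused : ∀ {j c d}, s(c, d) = s(a, b) → ¬ (T j).Adj c d := by
    intro j c d h hcd
    apply hab.2 j
    rw [← mem_edgeSet] at hcd ⊢
    rwa [← h]
  refine ⟨fun j c d h ↦ ?_, fun j ↦ ?_, fun j j' c d h h' ↦ ?_⟩
  · rcases hadj h with h | ⟨-, h⟩
    · exact hT.le j h
    · rw [← mem_edgeSet, h]
      exact hab.1
  · rcases eq_or_ne j i with rfl | hj
    · rw [Function.update_self]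
      exact ((hT.isAcyclic j).anti hK).sup_edge_of_not_reachable hnr
    · rw [Function.update_of_ne hj]
      exact hT.isAcyclic j
  · rcases hadj h with h | ⟨hj, h⟩ <;> rcases hadj h' with h' | ⟨hj', h'⟩
    · exact hT.disjoint h h'
    · exact absurd h (unused h')
    · exact absurd h' (unused h)
    · rw [hj, hj']

open Classical in
theorem finsum_ncard_update [Finite V] [Finite ι] (T : ι → SimpleGraph V) (i : ι) {a b : V} (hab : a ≠ b)
    (hK : ¬ K.Adj a b) :
    ∑ᶠ j, (Function.update T i (K ⊔ edge a b) j).edgeSet.ncard + (T i).edgeSet.ncard =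
      ∑ᶠ j, (T j).edgeSet.ncard + (K.edgeSet.ncard + 1) := by
  have := Fintype.ofFinite ι
  have hcard : (K ⊔ edge a b).edgeSet.ncard = K.edgeSet.ncard + 1 := by
    rw [edgeSet_sup, edgeSet_edge_of_ne hab, Set.union_singleton,
      Set.ncard_insert_of_notMem (show s(a, b) ∉ K.edgeSet from hK)]
  rw [finsum_eq_sum_of_fintype, finsum_eq_sum_of_fintype,
    ← Finset.add_sum_erase _ _ (Finset.mem_univ i),
    ← Finset.add_sum_erase Finset.univ (fun j ↦ (T j).edgeSet.ncard) (Finset.mem_univ i),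
    Function.update_self, hcard,
    Finset.sum_congr rfl fun j hj ↦ by rw [Function.update_of_ne (Finset.ne_of_mem_erase hj)]]
  ring

theorem IsMaxForestPacking.reachable_of_isUnused [Finite V] [Finite ι] {T : ι → SimpleGraph V}
    (hT : IsMaxForestPacking G T) {a b : V} (hab : IsUnused G T a b) (i : ι) :
    (T i).Reachable a b := by
  classical
  by_contra hnr
  have h₁ := hT.2 _ (hT.1.update hab (le_refl (T i)) hnr)
  have h₂ := finsum_ncard_update T i hab.1.ne (hab.2 i)
  omega

/-- `T'` arises from `T` by replacing an edge in one member by an unused edge. -/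
def IsExchange (G : SimpleGraph V) (T T' : ι → SimpleGraph V) : Prop :=
  IsMaxForestPacking G T' ∧ ∃ i a b, IsUnused G T a b ∧ T' i ≤ T i ⊔ edge a b ∧
    ∀ j ≠ i, T' j = T j

/-- Every edge on the path joining the ends of an unused edge can be exchanged for it. -/
theorem IsMaxForestPacking.exists_isExchange [Finite V] [Finite ι] {T : ι → SimpleGraph V}
    (hT : IsMaxForestPacking G T) {a b : V} (hab : IsUnused G T a b) {i : ι}
    {p : (T i).Walk a b} (hp : p.IsPath) {c d : V} (hcd : s(c, d) ∈ p.edges) :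
    ∃ T', IsExchange G T T' ∧ IsUnused G T' c d := by
  classical
  have hmem : (T i).Adj c d := p.adj_of_mem_edges hcd
  set K := (T i).deleteEdges {s(c, d)} with hKdef
  have hK : K ≤ T i := deleteEdges_le _
  have hnr : ¬ K.Reachable a b := by
    intro h
    obtain ⟨q, hq⟩ := h.exists_isPath
    have := (hT.1.isAcyclic i).subsingleton_path a b
    have heq := Subsingleton.elim (⟨q.mapLe hK, hq.mapLe hK⟩ : (T i).Path a b) ⟨p, hp⟩
    have hcd' : s(c, d) ∈ q.edges := by
      rw [← congrArg (fun r : (T i).Path a b ↦ r.1.edges) heq] at hcd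
      simpa using hcd
    have := q.adj_of_mem_edges hcd'
    simp [hKdef] at this
  have hcard := finsum_ncard_update T i hab.1.ne fun h ↦ hab.2 i (hK h)
  have hKcard : K.edgeSet.ncard + 1 = (T i).edgeSet.ncard := by
    rw [hKdef, edgeSet_deleteEdges]
    exact Set.ncard_sdiff_singleton_add_one hmem (Set.toFinite _)
  refine ⟨Function.update T i (K ⊔ edge a b), ⟨⟨hT.1.update hab hK hnr, fun T' hT' ↦ ?_⟩,
    i, a, b, hab, ?_, fun j hj ↦ Function.update_of_ne hj _ _⟩, hT.1.le i hmem, fun j ↦ ?_⟩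
  · have := hT.2 T' hT'
    omega
  · rw [Function.update_self]
    exact sup_le_sup_right hK _
  · rcases eq_or_ne j i with rfl | hj
    · rw [Function.update_self, sup_adj, edge_adj]
      rintro (h | ⟨h, -⟩)
      · simp [hKdef] at h
      · apply hab.2 j
        rcases h with ⟨rfl, rfl⟩ | ⟨rfl, rfl⟩
        · exact hmem
        · exact hmem.symm
    · rw [Function.update_of_ne hj]
      exact fun h ↦ hj (hT.1.disjoint h hmem)

/-- The edges which can be made unused by a chain of exchanges starting at `T`. -/
def exchangeGraph (G : SimpleGraph V) (T : ι → SimpleGraph V) : SimpleGraph V where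
  Adj a b := ∃ T', Relation.ReflTransGen (IsExchange G) T T' ∧ IsUnused G T' a b
  symm := ⟨fun _ _ ⟨T', h, h₁, h₂⟩ ↦ ⟨T', h, h₁.symm, fun i h ↦ h₂ i h.symm⟩⟩
  loopless := ⟨fun _ ⟨_, _, h, _⟩ ↦ h.ne rfl⟩

theorem IsMaxForestPacking.reflTransGen {T T' : ι → SimpleGraph V}
    (hT : IsMaxForestPacking G T) (h : Relation.ReflTransGen (IsExchange G) T T') :
    IsMaxForestPacking G T' := by
  cases h with
  | refl => exact hT
  | tail _ h => exact h.1

theorem IsMaxForestPacking.reachable_inf_of_isUnused [Finite V] [Finite ι] {T T' : ι → SimpleGraph V}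
    (hT : IsMaxForestPacking G T) (h : Relation.ReflTransGen (IsExchange G) T T') {a b : V}
    (hab : IsUnused G T' a b) (i : ι) : (T' i ⊓ exchangeGraph G T).Reachable a b := by
  have hT' := hT.reflTransGen h
  obtain ⟨p, hp⟩ := (hT'.reachable_of_isUnused hab i).exists_isPath
  refine ⟨p.transfer _ fun e he ↦ ?_⟩
  induction e with | _ c d =>
  obtain ⟨T'', hex, hcd⟩ := hT'.exists_isExchange hab hp he
  exact ⟨p.adj_of_mem_edges he, T'', h.tail hex, hcd⟩

theorem IsMaxForestPacking.reachable_inf_of_reflTransGen [Finite V] [Finite ι] {T T' : ι → SimpleGraph V}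
    (hT : IsMaxForestPacking G T) (h : Relation.ReflTransGen (IsExchange G) T T') {u v : V} {i : ι}
    (huv : (T' i ⊓ exchangeGraph G T).Reachable u v) :
    (T i ⊓ exchangeGraph G T).Reachable u v := by
  induction h with
  | refl => exact huv
  | tail h hex ih =>
    refine ih (huv.of_forall_adj fun c d hcd ↦ ?_)
    obtain ⟨-, j, a, b, hab, hle, heq⟩ := hex
    rcases eq_or_ne i j with rfl | hij
    · have hab' := hT.reachable_inf_of_isUnused h hab i
      rcases hle hcd.1 with h' | h'
      · exact Adj.reachable ⟨h', hcd.2⟩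
      · rw [edge_adj] at h'
        rcases h'.1 with ⟨rfl, rfl⟩ | ⟨rfl, rfl⟩
        · exact hab'
        · exact hab'.symm
    · rw [heq i hij] at hcd
      exact hcd.reachable

/-- Each member of a maximum forest packing spans the components of the exchange graph. -/
theorem IsMaxForestPacking.reachable_inf_iff [Finite V] [Finite ι] {T : ι → SimpleGraph V}
    (hT : IsMaxForestPacking G T) {u v : V} (i : ι) :
    (T i ⊓ exchangeGraph G T).Reachable u v ↔ (exchangeGraph G T).Reachable u v := by
  refine ⟨fun h ↦ h.mono inf_le_right, fun h ↦ h.of_forall_adj ?_⟩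
  rintro a b ⟨T', hT', hab⟩
  exact hT.reachable_inf_of_reflTransGen hT' (hT.reachable_inf_of_isUnused hT' hab i)

theorem IsMaxForestPacking.ncard_edgeSet_sdiff_lt [Finite V] [Finite ι] [Nonempty V] {T : ι → SimpleGraph V}
    (hT : IsMaxForestPacking G T) (i : ι) :
    ((T i).edgeSet \ (exchangeGraph G T).edgeSet).ncard <
      Nat.card (exchangeGraph G T).ConnectedComponent := by
  have h := (hT.1.isAcyclic i).ncard_edgeSet_sdiff_add_card_le
    (inf_le_left (b := exchangeGraph G T))
  have hc : Nat.card (T i ⊓ exchangeGraph G T).ConnectedComponent =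
      Nat.card (exchangeGraph G T).ConnectedComponent :=
    Nat.card_congr (Quot.congr (Equiv.refl V) fun _ _ ↦ hT.reachable_inf_iff i)
  have hpos : 0 < Nat.card (T i).ConnectedComponent := Nat.card_pos
  rw [edgeSet_inf, Set.sdiff_self_inter] at h
  omega

/-- **Nash-Williams–Tutte**: a graph in which every cut has at least `2k` edges contains `k`
pairwise edge-disjoint connected spanning subgraphs. -/
theorem exists_disjoint_connected [Finite V] [Finite ι] [Nonempty V] [Nonempty ι]
    (hG : ∀ X : Set V, X.Nonempty → Xᶜ.Nonempty →
      2 * Nat.card ι ≤ {d : V × V | d.1 ∈ X ∧ d.2 ∉ X ∧ G.Adj d.1 d.2}.ncard) :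
    ∃ T : ι → SimpleGraph V, (∀ i, T i ≤ G) ∧ (∀ i, (T i).Connected) ∧
      ∀ ⦃i j a b⦄, (T i).Adj a b → (T j).Adj a b → i = j := by
  classical
  have := Fintype.ofFinite ι
  have := Fintype.ofFinite V
  obtain ⟨T, hT⟩ := exists_isMaxForestPacking (ι := ι) G
  set H := exchangeGraph G T with hH
  have := Fintype.ofFinite H.ConnectedComponent
  suffices hconn : H.Preconnected from
    ⟨T, hT.1.le, fun i ↦ ⟨fun u v ↦ ((hT.reachable_inf_iff i).2 (hconn u v)).mono inf_le_left⟩,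
      hT.1.disjoint⟩
  by_contra hnconn
  let M : SimpleGraph V :=
    { Adj a b := G.Adj a b ∧ H.connectedComponentMk a ≠ H.connectedComponentMk b
      symm := ⟨fun _ _ h ↦ ⟨h.1.symm, h.2.symm⟩⟩
      loopless := ⟨fun _ h ↦ h.2 rfl⟩ }
  have upper : M.edgeFinset.card ≤
      ∑ i, ((T i).edgeSet \ H.edgeSet).ncard := by
    rw [← Set.ncard_coe_finset, coe_edgeFinset]
    refine (Set.ncard_le_ncard (t := ⋃ i, (T i).edgeSet \ H.edgeSet) ?_ (Set.toFinite _)).trans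
      (Set.ncard_iUnion_le_of_fintype _)
    intro e he
    induction e with | _ a b =>
    obtain ⟨hab, hne⟩ := he
    have hnH : ¬ H.Adj a b := fun h ↦ hne (ConnectedComponent.sound h.reachable)
    have : ¬ IsUnused G T a b := fun h ↦ hnH ⟨T, .refl, h⟩
    simp only [IsUnused, hab, true_and, not_forall, not_not] at this
    obtain ⟨i, hi⟩ := this
    exact Set.mem_iUnion.2 ⟨i, hi, hnH⟩
  have upper' : ∑ i, ((T i).edgeSet \ H.edgeSet).ncard <
      Fintype.card ι * Fintype.card H.ConnectedComponent := by
    rw [← smul_eq_mul, ← Finset.card_univ, ← Finset.sum_const]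
    refine Finset.sum_lt_sum_of_nonempty Finset.univ_nonempty fun i _ ↦ ?_
    rw [← Nat.card_eq_fintype_card]
    exact hT.ncard_edgeSet_sdiff_lt i
  have lower : Fintype.card H.ConnectedComponent * (2 * Fintype.card ι) ≤
      Fintype.card M.Dart := by
    rw [← Finset.card_univ (α := M.Dart), ← smul_eq_mul,
      ← Finset.card_univ (α := H.ConnectedComponent)]
    rw [Finset.card_eq_sum_card_fiberwise (f := fun d : M.Dart ↦ H.connectedComponentMk d.fst)
      (t := Finset.univ) (fun _ _ ↦ Finset.mem_coe.2 (Finset.mem_univ _))]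
    refine Finset.card_nsmul_le_sum _ _ _ fun C _ ↦ ?_
    have hC : C.suppᶜ.Nonempty := by
      by_contra hempty
      rw [Set.not_nonempty_iff_eq_empty, Set.compl_empty_iff] at hempty
      refine hnconn fun u v ↦ ConnectedComponent.exact ?_
      have hu : u ∈ C.supp := hempty ▸ Set.mem_univ u
      have hv : v ∈ C.supp := hempty ▸ Set.mem_univ v
      rw [ConnectedComponent.mem_supp_iff] at hu hv
      rw [hu, hv]
    have hcut := hG C.supp C.nonempty_supp hC
    rw [Nat.card_eq_fintype_card] at hcut
    refine hcut.trans ?_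
    rw [← Set.ncard_coe_finset]
    refine (Set.ncard_le_ncard ?_ (Set.toFinite _)).trans
      (Set.ncard_image_le (f := fun d : M.Dart ↦ d.toProd) (Set.toFinite _))
    rintro ⟨a, b⟩ ⟨ha, hb, hab⟩
    simp only [ConnectedComponent.mem_supp_iff] at ha hb
    exact ⟨⟨(a, b), hab, fun h ↦ hb (h ▸ ha)⟩, by simpa using ha, rfl⟩
  rw [dart_card_eq_twice_card_edges] at lower
  nlinarith

end TreePacking

end SimpleGraph

namespace SimpleGraph

variable {V : Type*} {G H : SimpleGraph V}

/-- The distance from `r` to the nearer end of an edge. -/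
noncomputable def edgeLevel (H : SimpleGraph V) (r : V) : Sym2 V → ℕ :=
  Sym2.lift ⟨fun a b ↦ min (H.dist r a) (H.dist r b), fun _ _ ↦ min_comm _ _⟩

theorem Connected.exists_adj_dist_eq (hH : H.Connected) {r u : V} (hu : u ≠ r) :
    ∃ v, H.Adj u v ∧ H.dist r u = H.dist r v + 1 := by
  obtain ⟨p, hp⟩ := hH.exists_walk_length_eq_dist u r
  cases p with
  | nil => exact absurd rfl hu
  | @cons _ v _ h q =>
    refine ⟨v, h, ?_⟩
    rw [Walk.length_cons, dist_comm] at hp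
    have h₁ := dist_le q
    have h₂ := hH.dist_triangle (u := r) (v := v) (w := u)
    have h₃ : H.dist v u = 1 := dist_eq_one_iff_adj.2 h.symm
    rw [dist_comm] at h₁
    omega

/-- From every vertex one can descend towards `r` along a path which stops on first meeting `S`. -/
theorem Connected.exists_descending_path (hH : H.Connected) {r : V} {S : Set V} (hr : r ∈ S)
    (u : V) :
    ∃ w ∈ S, ∃ p : H.Walk u w, p.IsPath ∧ (∀ x ∈ p.support, x ∈ S → x = w) ∧
      p.edges.map (H.edgeLevel r) = (List.range' (H.dist r w) p.length).reverse := by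
  suffices ∀ n u, H.dist r u = n → ∃ w ∈ S, ∃ p : H.Walk u w, p.IsPath ∧
      (∀ x ∈ p.support, x ∈ S → x = w) ∧ (∀ x ∈ p.support, H.dist r x ≤ n) ∧
      n = H.dist r w + p.length ∧
      p.edges.map (H.edgeLevel r) = (List.range' (H.dist r w) p.length).reverse by
    obtain ⟨w, hw, p, hp, hS, -, -, h⟩ := this _ u rfl
    exact ⟨w, hw, p, hp, hS, h⟩
  intro n
  induction n with
  | zero =>
    intro u hu
    obtain rfl : r = u := (hH.preconnected r u).dist_eq_zero_iff.1 hu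
    exact ⟨r, hr, .nil, by simp, by simp, by simp, by simp, by simp⟩
  | succ n ih =>
    intro u hu
    by_cases huS : u ∈ S
    · exact ⟨u, huS, .nil, by simp, by simp, by simp [hu], by simp [hu], by simp⟩
    obtain ⟨v, huv, hd⟩ := hH.exists_adj_dist_eq (r := r) (u := u) (by rintro rfl; exact huS hr)
    obtain ⟨w, hw, p, hp, hS, hle, hlen, hlev⟩ := ih v (by omega)
    refine ⟨w, hw, .cons huv p, ?_, ?_, ?_, ?_, ?_⟩
    · rw [Walk.cons_isPath_iff]
      refine ⟨hp, fun h ↦ ?_⟩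
      have := hle u h
      omega
    · intro x hx hxS
      rw [Walk.support_cons, List.mem_cons] at hx
      rcases hx with rfl | hx
      · exact absurd hxS huS
      · exact hS x hx hxS
    · intro x hx
      rw [Walk.support_cons, List.mem_cons] at hx
      rcases hx with rfl | hx
      · exact hu.le
      · exact (hle x hx).trans n.le_succ
    · rw [Walk.length_cons]
      omega
    · rw [Walk.length_cons, List.range'_concat, List.reverse_append, Walk.edges_cons,
        List.map_cons, hlev]
      simp only [edgeLevel, Sym2.lift_mk, List.reverse_singleton, List.singleton_append,
        List.cons.injEq, and_true]
      omega

theorem Walk.IsPath.append_of_forall_eq {u v w : V} {p : G.Walk u v} {q : G.Walk v w}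
    (hp : p.IsPath) (hq : q.IsPath) (h : ∀ x ∈ p.support, x ∈ q.support → x = v) :
    (p.append q).IsPath := by
  rw [Walk.isPath_def] at hp hq ⊢
  rw [Walk.support_append]
  rw [← Walk.cons_tail_support q, List.nodup_cons] at hq
  refine hp.append hq.2 fun x hx hx' ↦ ?_
  obtain rfl := h x hx (List.mem_of_mem_tail hx')
  exact hq.1 hx'

end SimpleGraph

theorem isNonrepetitivelyConnected_of_two_connected {V : Type*} [Nonempty V] {G : SimpleGraph V}
    {T₁ T₂ : SimpleGraph V} (hle₁ : T₁ ≤ G) (hle₂ : T₂ ≤ G) (h₁ : T₁.Connected)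
    (h₂ : T₂.Connected) (hdisj : ∀ ⦃a b⦄, T₁.Adj a b → ¬ T₂.Adj a b) :
    ∃ c : Sym2 V → Fin 6, IsNonrepetitivelyConnected G c := by
  classical
  obtain ⟨r⟩ := ‹Nonempty V›
  let φ₁ : Fin 3 → Fin 6 := Fin.castAdd 3
  let φ₂ : Fin 3 → Fin 6 := Fin.natAdd 3
  let c : Sym2 V → Fin 6 := fun e ↦
    if e ∈ T₁.edgeSet then φ₁ (ternaryThue (T₁.edgeLevel r e))
    else φ₂ (ternaryThue (T₂.edgeLevel r e))
  have hc₁ : ∀ {a b} (p : T₁.Walk a b),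
      p.edges.map c = ((p.edges.map (T₁.edgeLevel r)).map ternaryThue).map φ₁ := by
    intro a b p
    simp only [List.map_map]
    exact List.map_congr_left fun e he ↦ if_pos (p.edges_subset_edgeSet he)
  have hc₂ : ∀ {a b} (p : T₂.Walk a b),
      p.edges.map c = ((p.edges.map (T₂.edgeLevel r)).map ternaryThue).map φ₂ := by
    intro a b p
    simp only [List.map_map]
    refine List.map_congr_left fun e he ↦ if_neg ?_
    have he' := p.edges_subset_edgeSet he
    induction e with | _ a b => exact fun h ↦ hdisj h he'
  refine ⟨c, fun u v _ ↦ ?_⟩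
  obtain ⟨r', hr', q, hq, -, hqlev⟩ := h₂.exists_descending_path (Set.mem_singleton r) v
  obtain rfl : r' = r := hr'
  obtain ⟨w, hw, p, hp, hpS, hplev⟩ := h₁.exists_descending_path (S := {x | x ∈ q.support})
    q.end_mem_support u
  have hw' : w ∈ q.support := hw
  refine ⟨(p.mapLe hle₁).append ((q.takeUntil w hw').reverse.mapLe hle₂), ?_, ?_⟩
  · refine (hp.mapLe hle₁).append_of_forall_eq ((hq.takeUntil hw').reverse.mapLe hle₂) ?_
    intro x hx hx'
    simp only [Walk.support_mapLe_eq_support, Walk.support_reverse, List.mem_reverse] at hx hx'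
    exact hpS x hx (q.support_takeUntil_subset_support hw' hx')
  · rw [Walk.edges_append, List.map_append, Walk.edges_mapLe_eq_edges, Walk.edges_mapLe_eq_edges,
      hc₁]
    have hN₁ : NonrepetitiveSeq
        (((p.edges.map (T₁.edgeLevel r')).map ternaryThue).map φ₁) := by
      rw [hplev, List.map_reverse]
      exact ((nonrepetitiveSeq_map_ternaryThue _ _).reverse).map (Fin.castAdd_injective 3 3)
    have hN₂ : NonrepetitiveSeq (q.edges.map c) := by
      rw [hc₂, hqlev, List.map_reverse]
      exact ((nonrepetitiveSeq_map_ternaryThue _ _).reverse).map (Fin.natAdd_injective 3 3)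
    have hsub : (q.takeUntil w hw').edges <:+: q.edges := by
      conv_rhs => rw [← q.take_spec hw', Walk.edges_append]
      exact (List.prefix_append _ _).isInfix
    refine hN₁.append ?_ (fun x ↦ x.val < 3) ?_ ?_
    · rw [Walk.edges_reverse, List.map_reverse]
      exact (hN₂.of_isInfix (hsub.map c)).reverse
    · intro x hx
      obtain ⟨y, -, rfl⟩ := List.mem_map.1 hx
      exact y.2
    · intro x hx
      rw [hc₂] at hx
      obtain ⟨y, -, rfl⟩ := List.mem_map.1 hx
      simp [φ₂]

/-- Every 4-connected graph `G` satisfies `nrc(G) ≤ 6`. -/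
theorem nrc_le_six_of_four_connected {V : Type*} (G : SimpleGraph V)
    (hG : KConnected 4 G) :
    ∃ c : Sym2 V → Fin 6, IsNonrepetitivelyConnected G c := by
  have hcard : 0 < Nat.card V := (Nat.zero_le 4).trans_lt hG.1
  have := Nat.finite_of_card_ne_zero hcard.ne'
  have := (Nat.card_pos_iff.1 hcard).1
  obtain ⟨T, hle, hconn, hdisj⟩ := SimpleGraph.exists_disjoint_connected (G := G) (ι := Bool)
    fun X hX hX' ↦ by simpa using hG.le_ncard_boundary hX hX'
  exact isNonrepetitivelyConnected_of_two_connected (hle false) (hle true) (hconn false)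
    (hconn true) fun a b h h' ↦ Bool.false_ne_true (hdisj h h')
end
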